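/- arXiv:0908.3554 — 4 statements merged into one kernel-verified Lean document; each statement's English description precedes it below -/
import Mathlib

section
/- Let k be a field, let p₁, …, p_d ∈ k be pairwise distinct, and set A₁ = blockdiag(I, …, I) and A₂ = blockdiag(D₁, …, D_d), where I = [[0,1],[−1,0]] and Dᵢ = [[0,pᵢ],[−pᵢ,0]]. Then an invertible 2d×2d matrix R over k satisfies R A₁ Rᵗ = A₁ and R A₂ Rᵗ = A₂ if and only if R = blockdiag(R₁, …, R_d) where each Rᵢ is an invertible 2×2 matrix with det Rᵢ = 1. -/
open Matrix

/-- The block-diagonal `2d × 2d` matrix with the given `2 × 2` blocks on the diagonal. -/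
def blockDiag2 {k : Type*} [Zero k] (d : ℕ) (B : Fin d → Matrix (Fin 2) (Fin 2) k) :
    Matrix (Fin (2 * d)) (Fin (2 * d)) k :=
  Matrix.of fun i j =>
    if (i : ℕ) / 2 = (j : ℕ) / 2 then
      B ⟨(i : ℕ) / 2, by have := i.isLt; omega⟩
        ⟨(i : ℕ) % 2, by omega⟩ ⟨(j : ℕ) % 2, by omega⟩
    else 0

/-- A position in `Fin (2 * d)` as a pair (position within its block, block index). -/
def finTwoMulEquiv (d : ℕ) : Fin (2 * d) ≃ Fin 2 × Fin d where
  toFun i := (⟨(i : ℕ) % 2, by omega⟩, ⟨(i : ℕ) / 2, by have := i.isLt; omega⟩)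
  invFun x := ⟨2 * (x.2 : ℕ) + (x.1 : ℕ), by have := x.1.isLt; have := x.2.isLt; omega⟩
  left_inv i := by
    ext
    simp only
    omega
  right_inv x := by
    have := x.1.isLt
    ext <;> simp only <;> omega

theorem blockDiag2_eq_submatrix {k : Type*} [Zero k] (d : ℕ)
    (B : Fin d → Matrix (Fin 2) (Fin 2) k) :
    blockDiag2 d B =
      (blockDiagonal B).submatrix (finTwoMulEquiv d) (finTwoMulEquiv d) := by
  ext i j
  simp [blockDiag2, blockDiagonal_apply, finTwoMulEquiv, Fin.ext_iff]

theorem blockDiag2_mul {k : Type*} [NonUnitalNonAssocSemiring k] (d : ℕ)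
    (B C : Fin d → Matrix (Fin 2) (Fin 2) k) :
    blockDiag2 d (fun i => B i * C i) = blockDiag2 d B * blockDiag2 d C := by
  simp only [blockDiag2_eq_submatrix, submatrix_mul_equiv, blockDiagonal_mul]

theorem blockDiag2_transpose {k : Type*} [Zero k] (d : ℕ)
    (B : Fin d → Matrix (Fin 2) (Fin 2) k) :
    (blockDiag2 d B)ᵀ = blockDiag2 d fun i => (B i)ᵀ := by
  simp only [blockDiag2_eq_submatrix, transpose_submatrix, blockDiagonal_transpose]

theorem blockDiag2_injective {k : Type*} [Zero k] (d : ℕ) :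
    Function.Injective (blockDiag2 (k := k) d) := by
  intro B C h
  apply blockDiagonal_injective
  simp only [blockDiag2_eq_submatrix] at h
  simpa using congrArg
    (fun M => M.submatrix (finTwoMulEquiv d).symm (finTwoMulEquiv d).symm) h

theorem blockDiag2_smul_one {k : Type*} [Semiring k] (d : ℕ) (p : Fin d → k) :
    blockDiag2 d (fun i => p i • (1 : Matrix (Fin 2) (Fin 2) k)) =
      diagonal fun i => p (finTwoMulEquiv d i).2 := by
  ext i j
  rw [blockDiag2_eq_submatrix, submatrix_apply, blockDiagonal_apply, diagonal_apply]
  simp only [Matrix.smul_apply, one_apply, smul_eq_mul, mul_ite, mul_one, mul_zero, ← ite_and,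
    ← (finTwoMulEquiv d).injective.eq_iff (a := i), Prod.ext_iff, and_comm]

theorem eq_blockDiag2_of_apply_eq_zero {k : Type*} [Zero k] {d : ℕ}
    {R : Matrix (Fin (2 * d)) (Fin (2 * d)) k}
    (h : ∀ i j, (finTwoMulEquiv d i).2 ≠ (finTwoMulEquiv d j).2 → R i j = 0) :
    R = blockDiag2 d fun n => of fun a b =>
      R ((finTwoMulEquiv d).symm (a, n)) ((finTwoMulEquiv d).symm (b, n)) := by
  ext i j
  rw [blockDiag2_eq_submatrix, submatrix_apply, blockDiagonal_apply]
  split_ifs with hij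
  · rw [of_apply, Prod.mk.eta]
    conv_rhs => rw [hij, Prod.mk.eta]
    simp
  · exact h i j hij

theorem mul_symplectic_mul_transpose {k : Type*} [CommRing k] (q : k)
    (B : Matrix (Fin 2) (Fin 2) k) :
    B * !![0, q; -q, 0] * Bᵀ = !![0, B.det * q; -(B.det * q), 0] := by
  ext i j
  fin_cases i <;> fin_cases j <;>
    simp [mul_apply, Fin.sum_univ_two, det_fin_two] <;> ring

theorem isUnit_blockDiag2_symplectic {k : Type*} [CommRing k] (d : ℕ) :
    IsUnit (blockDiag2 d fun _ => (!![0, 1; -1, 0] : Matrix (Fin 2) (Fin 2) k)) := by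
  have h : (blockDiag2 d fun _ => (!![0, 1; -1, 0] : Matrix (Fin 2) (Fin 2) k)) *
      blockDiag2 d (fun _ => !![0, -1; 1, 0]) = 1 := by
    rw [← blockDiag2_mul]
    have := blockDiag2_smul_one d (fun _ => (1 : k))
    simpa [← one_fin_two] using this
  exact (isUnit_iff_isUnit_det _).2 (isUnit_det_of_right_inverse h)

/-- An invertible `2d × 2d` matrix `R` satisfies `R A₁ Rᵗ = A₁` and `R A₂ Rᵗ = A₂`,
where `A₁ = blockdiag(I,…,I)` and `A₂ = blockdiag(D₁,…,D_d)` with pairwise distinct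
`pᵢ`, if and only if `R` is block-diagonal with `2 × 2` blocks of determinant one. -/
theorem stmt1 {k : Type} [Field k] (d : ℕ) (p : Fin d → k) (hp : Function.Injective p)
    (R : Matrix (Fin (2 * d)) (Fin (2 * d)) k) (hR : IsUnit R.det) :
    (R * blockDiag2 d (fun _ => !![0, 1; -1, 0]) * Rᵀ =
        blockDiag2 d (fun _ => !![0, 1; -1, 0]) ∧
      R * blockDiag2 d (fun i => !![0, p i; -(p i), 0]) * Rᵀ =
        blockDiag2 d (fun i => !![0, p i; -(p i), 0])) ↔
    ∃ B : Fin d → Matrix (Fin 2) (Fin 2) k,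
      (∀ i, IsUnit (B i).det ∧ (B i).det = 1) ∧ R = blockDiag2 d B := by
  constructor
  · rintro ⟨h₁, h₂⟩
    have hfac : blockDiag2 d (fun i => !![0, p i; -(p i), 0]) =
        diagonal (fun i => p (finTwoMulEquiv d i).2) *
          blockDiag2 d (fun _ => !![0, 1; -1, 0]) := by
      rw [← blockDiag2_smul_one, ← blockDiag2_mul]
      simp
    have hunit : IsUnit (blockDiag2 d (fun _ => !![0, 1; -1, 0]) * Rᵀ) :=
      (isUnit_blockDiag2_symplectic d).mul
        ((isUnit_iff_isUnit_det _).2 (by rwa [det_transpose]))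
    have hcomm : R * diagonal (fun i => p (finTwoMulEquiv d i).2) =
        diagonal (fun i => p (finTwoMulEquiv d i).2) * R := by
      apply hunit.mul_right_cancel
      rw [hfac] at h₂
      simp only [Matrix.mul_assoc] at h₁ h₂ ⊢
      rw [h₂, h₁]
    obtain ⟨B, rfl⟩ : ∃ B, R = blockDiag2 d B := by
      refine ⟨_, eq_blockDiag2_of_apply_eq_zero fun i j hij => ?_⟩
      have h := congrFun (congrFun hcomm i) j
      rw [mul_diagonal, diagonal_mul, mul_comm, ← sub_eq_zero, ← sub_mul] at h
      exact (mul_eq_zero.1 h).resolve_left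
        (sub_ne_zero.2 fun hp' => hij (hp hp').symm)
    refine ⟨B, fun n => ?_, rfl⟩
    rw [blockDiag2_transpose, ← blockDiag2_mul, ← blockDiag2_mul] at h₁
    have h := congrFun (congrFun (congrFun (blockDiag2_injective d h₁) n) 0) 1
    rw [mul_symplectic_mul_transpose] at h
    have hdet : (B n).det = 1 := by simpa using h
    exact ⟨hdet ▸ isUnit_one, hdet⟩
  · rintro ⟨B, hB, rfl⟩
    simp only [blockDiag2_transpose, ← blockDiag2_mul, mul_symplectic_mul_transpose,
      (hB _).2, one_mul, and_self]
end

section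
/- Let σ₁, σ₂, γ be 2d×2d skew-symmetric matrices over a field k, let λ = (λ₁,λ₂) and μ = (μ₁,μ₂) be distinct points of k², and let v, u ∈ k^{2d} satisfy (λ₁σ₂ − λ₂σ₁ + γ)v = 0 and (μ₁σ₂ − μ₂σ₁ + γ)u = 0. Then (λ₁ − μ₁)·vᵗσ₂u = (λ₂ − μ₂)·vᵗσ₁u. Consequently there is a unique scalar K ∈ k with vᵗσ₁u = (λ₁ − μ₁)K and vᵗσ₂u = (λ₂ − μ₂)K, and for all t₁, t₂ ∈ k with t₁(λ₁ − μ₁) + t₂(λ₂ − μ₂) ≠ 0 one has vᵗ(t₁σ₁ + t₂σ₂)u = K·(t₁(λ₁ − μ₁) + t₂(λ₂ − μ₂)). -/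
open Matrix

/-- The bilinear pairing of a kernel vector of a skew-symmetric matrix with any vector
vanishes. -/
theorem dotProduct_mulVec_eq_zero_of_skew {n R : Type*} [Fintype n] [CommRing R]
    {A : Matrix n n R} (hA : Aᵀ = -A) {v : n → R} (hv : A *ᵥ v = 0) (u : n → R) :
    v ⬝ᵥ A *ᵥ u = 0 := by
  rw [dotProduct_mulVec, ← mulVec_transpose, hA, neg_mulVec, hv, neg_zero, zero_dotProduct]

/-- A vector `(a, b)` proportional to a nonzero vector `(x, y)` of a plane is a unique multiple
of it. -/
theorem existsUnique_eq_mul_of_mul_eq_mul {k : Type*} [Field k] {x y a b : k}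
    (hxy : x ≠ 0 ∨ y ≠ 0) (h : x * b = y * a) : ∃! K : k, a = x * K ∧ b = y * K := by
  rcases hxy with hx | hy
  · refine ⟨a / x, ⟨by field_simp, by field_simp; linear_combination h⟩, ?_⟩
    rintro K ⟨rfl, -⟩
    field_simp
  · refine ⟨b / y, ⟨by field_simp; linear_combination -h, by field_simp⟩, ?_⟩
    rintro K ⟨-, rfl⟩
    field_simp

/-- For skew-symmetric `σ₁, σ₂, γ`, distinct points `λ = (λ₁,λ₂)`, `μ = (μ₁,μ₂)` and
kernel vectors `v` of `λ₁σ₂ − λ₂σ₁ + γ` and `u` of `μ₁σ₂ − μ₂σ₁ + γ`, one has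
`(λ₁ − μ₁)·vᵗσ₂u = (λ₂ − μ₂)·vᵗσ₁u`; consequently there is a unique scalar `K` with
`vᵗσ₁u = (λ₁ − μ₁)K` and `vᵗσ₂u = (λ₂ − μ₂)K`, and whenever
`t₁(λ₁ − μ₁) + t₂(λ₂ − μ₂) ≠ 0` we have
`vᵗ(t₁σ₁ + t₂σ₂)u = K·(t₁(λ₁ − μ₁) + t₂(λ₂ − μ₂))`. -/
theorem stmt9 {k : Type} [Field k] (d : ℕ)
    (σ1 σ2 γ : Matrix (Fin (2 * d)) (Fin (2 * d)) k)
    (hσ1 : σ1ᵀ = -σ1) (hσ2 : σ2ᵀ = -σ2) (hγ : γᵀ = -γ)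
    (l1 l2 m1 m2 : k) (hne : (l1, l2) ≠ (m1, m2))
    (v u : Fin (2 * d) → k)
    (hv : (l1 • σ2 - l2 • σ1 + γ).mulVec v = 0)
    (hu : (m1 • σ2 - m2 • σ1 + γ).mulVec u = 0) :
    (l1 - m1) * (v ⬝ᵥ σ2.mulVec u) = (l2 - m2) * (v ⬝ᵥ σ1.mulVec u) ∧
    ∃! K : k,
      (v ⬝ᵥ σ1.mulVec u = (l1 - m1) * K ∧ v ⬝ᵥ σ2.mulVec u = (l2 - m2) * K) ∧
      ∀ t1 t2 : k, t1 * (l1 - m1) + t2 * (l2 - m2) ≠ 0 →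
        v ⬝ᵥ (t1 • σ1 + t2 • σ2).mulVec u = K * (t1 * (l1 - m1) + t2 * (l2 - m2)) := by
  have hne' : l1 - m1 ≠ 0 ∨ l2 - m2 ≠ 0 := by
    by_contra! h
    exact hne (Prod.ext (sub_eq_zero.mp h.1) (sub_eq_zero.mp h.2))
  have hskew : (l1 • σ2 - l2 • σ1 + γ)ᵀ = -(l1 • σ2 - l2 • σ1 + γ) := by
    simp only [transpose_add, transpose_sub, transpose_smul, hσ1, hσ2, hγ, smul_neg]
    abel
  have hv' := dotProduct_mulVec_eq_zero_of_skew hskew hv u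
  have hu' : v ⬝ᵥ (m1 • σ2 - m2 • σ1 + γ) *ᵥ u = 0 := by rw [hu, dotProduct_zero]
  simp only [add_mulVec, sub_mulVec, smul_mulVec, dotProduct_add, dotProduct_sub,
    dotProduct_smul, smul_eq_mul] at hv' hu' ⊢
  have key : (l1 - m1) * (v ⬝ᵥ σ2 *ᵥ u) = (l2 - m2) * (v ⬝ᵥ σ1 *ᵥ u) := by
    linear_combination hv' - hu'
  obtain ⟨K, ⟨h1, h2⟩, hK⟩ := existsUnique_eq_mul_of_mul_eq_mul hne' key
  refine ⟨key, K, ⟨⟨h1, h2⟩, fun t1 t2 _ => ?_⟩, fun L hL => hK L hL.1⟩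
  rw [h1, h2]
  ring
end

section
/- In the Type II setup, the pfaffians agree: Pf(y₁σ₂ − y₂σ₁ + γ̄) = Pf(y₁σ₂ − y₂σ₁ + γ) for all (y₁,y₂) ∈ k² (equivalently, as polynomials in y₁, y₂). In particular, if y₁σ₂ − y₂σ₁ + γ is a pfaffian representation of an affine plane curve f(y₁,y₂) = 0, then so is y₁σ₂ − y₂σ₁ + γ̄. -/
open Matrix MvPolynomial

/-- The pfaffian of an `m × m` matrix over a commutative ring, defined by expansion
along the first row; it equals `1` for `m = 0` and `0` for odd `m`.  For a
skew-symmetric matrix of even size it is the unique polynomial in the entries whose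
square is the determinant and whose value on the standard symplectic block-diagonal
matrix is `1`. -/
def Matrix.pf {R : Type*} [CommRing R] : (m : ℕ) → Matrix (Fin m) (Fin m) R → R
  | 0, _ => 1
  | 1, _ => 0
  | m + 2, A =>
      ∑ j : Fin (m + 1),
        (-1 : R) ^ (j : ℕ) * A 0 j.succ *
          Matrix.pf m (A.submatrix (Fin.succ ∘ j.succAbove) (Fin.succ ∘ j.succAbove))

namespace ExteriorAlgebra

variable {R M : Type*} [CommRing R] [AddCommGroup M] [Module R M]

theorem contractLeft_ιMulti_succ (f : Module.Dual R M) (n : ℕ) (w : Fin (n + 1) → M) :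
    CliffordAlgebra.contractLeft (Q := (0 : QuadraticForm R M)) f (ιMulti R (n + 1) w) =
      ∑ j : Fin (n + 1), ((-1 : R) ^ (j : ℕ) * f (w j)) • ιMulti R n (w ∘ j.succAbove) := by
  induction n with
  | zero =>
    rw [ιMulti_succ_apply, ιMulti_zero_apply, mul_one]
    simp [Algebra.algebraMap_eq_smul_one]
  | succ n ih =>
    rw [ιMulti_succ_apply]
    refine (CliffordAlgebra.contractLeft_ι_mul f (w 0) _).trans ?_
    conv_rhs => rw [Fin.sum_univ_succ]
    rw [ih, sub_eq_add_neg, Finset.mul_sum, ← Finset.sum_neg_distrib]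
    congr 1
    · simp [Matrix.vecTail, Function.comp_def]
    · refine Finset.sum_congr rfl fun j _ => ?_
      have h : Matrix.vecTail (w ∘ j.succ.succAbove) = Matrix.vecTail w ∘ j.succAbove := by
        ext i
        simp [Matrix.vecTail]
      rw [ιMulti_succ_apply, h, mul_smul_comm, ← neg_smul]
      congr 1
      simp [Matrix.vecTail, pow_succ]

/-- For an alternating bilinear form `B`, the alternating map sending `w` to the pfaffian of the
Gram matrix `B (w i) (w j)`, obtained as the scalar part of a deformed exterior product. -/
noncomputable def pfaffianForm (B : LinearMap.BilinForm R M)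
    (h : (-B).toQuadraticMap = (0 : QuadraticForm R M) - 0) (n : ℕ) : M [⋀^Fin n]→ₗ[R] R :=
  ((algebraMapInv (R := R) (M := M)).toLinearMap ∘ₗ
    CliffordAlgebra.changeForm h).compAlternatingMap (ιMulti R n)

theorem pfaffianForm_apply (B : LinearMap.BilinForm R M)
    (h : (-B).toQuadraticMap = (0 : QuadraticForm R M) - 0) (n : ℕ) (w : Fin n → M) :
    pfaffianForm B h n w = algebraMapInv (CliffordAlgebra.changeForm h (ιMulti R n w)) :=
  rfl

theorem algebraMapInv_ι_mul (m : M) (x : ExteriorAlgebra R M) :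
    algebraMapInv (ι R m * x) = 0 := by
  simp [algebraMapInv]

theorem pfaffianForm_succ (B : LinearMap.BilinForm R M)
    (h : (-B).toQuadraticMap = (0 : QuadraticForm R M) - 0) (n : ℕ) (w : Fin (n + 1) → M) :
    pfaffianForm B h (n + 1) w =
      algebraMapInv (CliffordAlgebra.changeForm h
        (CliffordAlgebra.contractLeft (B (w 0)) (ιMulti R n (Matrix.vecTail w)))) := by
  rw [pfaffianForm_apply, ιMulti_succ_apply, CliffordAlgebra.changeForm_contractLeft]
  refine (congrArg _ (CliffordAlgebra.changeForm_ι_mul h (w 0) _)).trans ?_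
  rw [map_sub]
  refine (congrArg₂ _ (algebraMapInv_ι_mul (w 0) _) rfl).trans ?_
  simp

theorem pfaffianForm_eq_pf (B : LinearMap.BilinForm R M)
    (h : (-B).toQuadraticMap = (0 : QuadraticForm R M) - 0) :
    ∀ (n : ℕ) (w : Fin n → M),
      pfaffianForm B h n w = Matrix.pf n (Matrix.of fun i j => B (w i) (w j))
  | 0, w => by
    rw [pfaffianForm_apply, ιMulti_zero_apply, Matrix.pf]
    exact (congrArg _ (CliffordAlgebra.changeForm_one h)).trans (map_one _)
  | 1, w => by
    rw [pfaffianForm_succ, ιMulti_zero_apply, Matrix.pf]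
    rw [CliffordAlgebra.contractLeft_one, map_zero, map_zero]
  | n + 2, w => by
    rw [pfaffianForm_succ, contractLeft_ιMulti_succ, Matrix.pf, map_sum, map_sum]
    refine Finset.sum_congr rfl fun j _ => ?_
    rw [map_smul, map_smul, ← pfaffianForm_apply, pfaffianForm_eq_pf B h n]
    rfl

end ExteriorAlgebra

namespace Matrix

variable {R : Type*} [CommRing R] {n : ℕ}

theorem pf_mul_mul_transpose (A P : Matrix (Fin n) (Fin n) R)
    (hA : ∀ x, x ⬝ᵥ A *ᵥ x = 0) : pf n (P * A * Pᵀ) = P.det * pf n A := by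
  have h : (-(Matrix.toBilin' A)).toQuadraticMap = (0 : QuadraticForm R (Fin n → R)) - 0 := by
    ext x
    simp [Matrix.toBilin'_apply', hA]
  have key : ExteriorAlgebra.pfaffianForm _ h n (fun i => P i) =
      ExteriorAlgebra.pfaffianForm _ h n (Pi.basisFun R (Fin n)) * P.det := by
    conv_lhs =>
      rw [(ExteriorAlgebra.pfaffianForm _ h n).eq_smul_basis_det (Pi.basisFun R (Fin n))]
    rw [AlternatingMap.smul_apply, Pi.basisFun_det_apply, smul_eq_mul]
    rfl
  simp only [ExteriorAlgebra.pfaffianForm_eq_pf, Matrix.toBilin'_apply'] at key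
  rw [mul_comm]
  convert key using 2
  · ext i j
    simp only [of_apply, Matrix.mul_assoc]
    rfl
  · congr 1
    ext i j
    simp

theorem dotProduct_mulVec_comm_neg {A : Matrix (Fin n) (Fin n) R} (hA : Aᵀ = -A)
    (x y : Fin n → R) : x ⬝ᵥ A *ᵥ y = -(y ⬝ᵥ A *ᵥ x) := by
  rw [dotProduct_mulVec, ← mulVec_transpose, hA, neg_mulVec, neg_dotProduct, dotProduct_comm]

theorem pf_sub_smul_vecMulVec (A : Matrix (Fin n) (Fin n) R) (hskew : Aᵀ = -A)
    (hA : ∀ x, x ⬝ᵥ A *ᵥ x = 0) (v c : Fin n → R) (hc : v ⬝ᵥ c = 0) (s : R) :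
    pf n (A - s • (vecMulVec c (A *ᵥ v) - vecMulVec (A *ᵥ v) c)) = pf n A := by
  have hvA : v ᵥ* A = -(A *ᵥ v) := by rw [← mulVec_transpose, hskew, neg_mulVec]
  have hdet : (1 + vecMulVec (s • c) v).det = 1 := by
    rw [vecMulVec_eq Unit, det_one_add_replicateCol_mul_replicateRow, dotProduct_smul, hc]
    simp
  have h := pf_mul_mul_transpose A (1 + vecMulVec (s • c) v) hA
  rw [hdet, one_mul] at h
  rw [← h]
  congr 1
  have hw : (A *ᵥ v) ⬝ᵥ v = 0 := by rw [dotProduct_comm, hA]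
  simp only [transpose_add, transpose_one, transpose_vecMulVec, Matrix.add_mul, Matrix.mul_add,
    Matrix.one_mul, Matrix.mul_one, vecMulVec_mul, mul_vecMulVec, hvA, vecMulVec_neg,
    add_mulVec, neg_mulVec, vecMulVec_mulVec, hw]
  ext i j
  simp [vecMulVec_apply]
  ring

theorem pf_eq_zero_of_mulVec_eq_zero {K : Type*} [Field K] (A : Matrix (Fin n) (Fin n) K)
    (hskew : Aᵀ = -A) (hA : ∀ x, x ⬝ᵥ A *ᵥ x = 0) {v : Fin n → K} (hv0 : v ≠ 0)
    (hv : A *ᵥ v = 0) : pf n A = 0 := by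
  obtain ⟨i, hi⟩ := Function.ne_iff.1 hv0
  have hvA : v ᵥ* A = 0 := by rw [← mulVec_transpose, hskew, neg_mulVec, hv, neg_zero]
  have hdet : (1 + vecMulVec (Pi.single i (-(v i)⁻¹)) v).det = 0 := by
    rw [vecMulVec_eq Unit, det_one_add_replicateCol_mul_replicateRow, dotProduct_single, mul_neg,
      mul_inv_cancel₀ hi, add_neg_cancel]
  have h := pf_mul_mul_transpose A (1 + vecMulVec (Pi.single i (-(v i)⁻¹)) v) hA
  rw [hdet, zero_mul] at h
  rw [← h]
  congr 1
  simp [transpose_add, transpose_vecMulVec, Matrix.add_mul, Matrix.mul_add,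
    vecMulVec_mul, mul_vecMulVec, hvA, hv]

theorem dotProduct_mulVec_self_eq_zero {K : Type*} [Field K] (h2 : (2 : K) ≠ 0)
    {A : Matrix (Fin n) (Fin n) K} (hA : Aᵀ = -A) (x : Fin n → K) : x ⬝ᵥ A *ᵥ x = 0 := by
  have h := dotProduct_mulVec_comm_neg hA x x
  have h' : 2 * (x ⬝ᵥ A *ᵥ x) = 0 := by linear_combination h
  exact (mul_eq_zero.1 h').resolve_left h2

theorem pf_type_two_transformation {K : Type*} [Field K] (σ1 σ2 γ : Matrix (Fin n) (Fin n) K)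
    (hσ1 : σ1ᵀ = -σ1) (hσ2 : σ2ᵀ = -σ2) (hγ : γᵀ = -γ)
    (l1 l2 : K) (v : Fin n → K) (hv0 : v ≠ 0)
    (hv : (l1 • σ2 - l2 • σ1 + γ) *ᵥ v = 0) (ρ y1 y2 : K) :
    pf n (y1 • σ2 - y2 • σ1 +
        (γ + (2 * ρ) • (σ1 * vecMulVec v v * σ2 - σ2 * vecMulVec v v * σ1))) =
      pf n (y1 • σ2 - y2 • σ1 + γ) := by
  by_cases h2 : (2 : K) = 0
  · simp [h2]
  set A := y1 • σ2 - y2 • σ1 + γ with hAdef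
  have hskew : Aᵀ = -A := by
    simp only [hAdef, transpose_add, transpose_sub, transpose_smul, hσ1, hσ2, hγ, smul_neg]
    abel
  have hA := dotProduct_mulVec_self_eq_zero h2 hskew
  have hw : A *ᵥ v = (y1 - l1) • σ2 *ᵥ v - (y2 - l2) • σ1 *ᵥ v := by
    rw [← sub_zero (A *ᵥ v), ← hv, hAdef]
    simp only [add_mulVec, sub_mulVec, smul_mulVec]
    module
  have hv1 : v ⬝ᵥ σ1 *ᵥ v = 0 := dotProduct_mulVec_self_eq_zero h2 hσ1 v
  have hv2 : v ⬝ᵥ σ2 *ᵥ v = 0 := dotProduct_mulVec_self_eq_zero h2 hσ2 v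
  have hvσ1 : v ᵥ* σ1 = -(σ1 *ᵥ v) := by rw [← mulVec_transpose, hσ1, neg_mulVec]
  have hvσ2 : v ᵥ* σ2 = -(σ2 *ᵥ v) := by rw [← mulVec_transpose, hσ2, neg_mulVec]
  have hN : y1 • σ2 - y2 • σ1 +
        (γ + (2 * ρ) • (σ1 * vecMulVec v v * σ2 - σ2 * vecMulVec v v * σ1)) =
      A - (2 * ρ) • (vecMulVec (σ1 *ᵥ v) (σ2 *ᵥ v) - vecMulVec (σ2 *ᵥ v) (σ1 *ᵥ v)) := by
    simp only [mul_vecMulVec, vecMulVec_mul, hvσ1, hvσ2, vecMulVec_neg, hAdef]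
    module
  rw [hN]
  generalize σ1 *ᵥ v = a at *
  generalize σ2 *ᵥ v = b at *
  by_cases hp : y1 - l1 = 0
  · by_cases hq : y2 - l2 = 0
    · have hAv : A *ᵥ v = 0 := by simp [hw, hp, hq]
      rw [pf_eq_zero_of_mulVec_eq_zero A hskew hA hv0 hAv]
      have hskew' : (A - (2 * ρ) • (vecMulVec a b - vecMulVec b a))ᵀ =
          -(A - (2 * ρ) • (vecMulVec a b - vecMulVec b a)) := by
        simp only [transpose_sub, transpose_smul, transpose_vecMulVec, hskew]
        module
      refine pf_eq_zero_of_mulVec_eq_zero _ hskew'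
        (dotProduct_mulVec_self_eq_zero h2 hskew') hv0 ?_
      rw [dotProduct_comm] at hv1 hv2
      simp [sub_mulVec, smul_mulVec, vecMulVec_mulVec, hAv, hv1, hv2]
    · rw [← pf_sub_smul_vecMulVec A hskew hA v b hv2 (2 * ρ / (y2 - l2)), hw]
      congr 2
      ext i j
      simp [vecMulVec_apply]
      field_simp
      ring
  · rw [← pf_sub_smul_vecMulVec A hskew hA v a hv1 (2 * ρ / (y1 - l1)), hw]
    congr 2
    ext i j
    simp [vecMulVec_apply]
    field_simp
    ring

end Matrix

/-- **Type II elementary transformations preserve the pfaffian.**  In the Type II setup,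
`Pf(y₁σ₂ − y₂σ₁ + γ̄) = Pf(y₁σ₂ − y₂σ₁ + γ)` for all `(y₁,y₂)`; in particular, if
`y₁σ₂ − y₂σ₁ + γ` is a pfaffian representation of an affine plane curve `f = 0`,
then so is `y₁σ₂ − y₂σ₁ + γ̄`. -/
theorem stmt13 {k : Type} [Field k] [IsAlgClosed k] (d : ℕ)
    (σ1 σ2 γ : Matrix (Fin (2 * d)) (Fin (2 * d)) k)
    (hσ1 : σ1ᵀ = -σ1) (hσ2 : σ2ᵀ = -σ2) (hγ : γᵀ = -γ)
    (l1 l2 : k) (v : Fin (2 * d) → k) (hv0 : v ≠ 0)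
    (hv : (l1 • σ2 - l2 • σ1 + γ).mulVec v = 0)
    (ρ : k)
    (γb : Matrix (Fin (2 * d)) (Fin (2 * d)) k)
    (hγb : γb = γ + (2 * ρ) • (σ1 * vecMulVec v v * σ2 - σ2 * vecMulVec v v * σ1)) :
    (∀ y1 y2 : k,
      Matrix.pf (2 * d) (y1 • σ2 - y2 • σ1 + γb) =
        Matrix.pf (2 * d) (y1 • σ2 - y2 • σ1 + γ)) ∧
    (∀ (f : MvPolynomial (Fin 2) k) (c : k), c ≠ 0 →
      (∀ y1 y2 : k,
        Matrix.pf (2 * d) (y1 • σ2 - y2 • σ1 + γ) = c * eval ![y1, y2] f) →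
      ∀ y1 y2 : k,
        Matrix.pf (2 * d) (y1 • σ2 - y2 • σ1 + γb) = c * eval ![y1, y2] f) := by
  subst hγb
  have h := Matrix.pf_type_two_transformation σ1 σ2 γ hσ1 hσ2 hγ l1 l2 v hv0 hv ρ
  exact ⟨h, fun f c _ hf y1 y2 => (h y1 y2).trans (hf y1 y2)⟩
end

section
/- In the Type II setup, fix t₁, t₂ ∈ k and for x = (x₀,x₁,x₂) ∈ k³ write Σ = t₁σ₁ + t₂σ₂, δ_λ(x) = t₁(x₁ − λ₁x₀) + t₂(x₂ − λ₂x₀), A(x) = x₁σ₂ − x₂σ₁ + x₀γ, Ā(x) = x₁σ₂ − x₂σ₁ + x₀γ̄, and define Q(x) = Id + 2ρ x₀ δ_λ(x)⁻¹ vvᵗΣ. Then for every x with δ_λ(x) ≠ 0: Q(x) is invertible with Q(x)⁻¹ = Id − 2ρ x₀ δ_λ(x)⁻¹ vvᵗΣ, the identity A(x) = Qᵗ(x)·Ā(x)·Q(x) holds, and Q(x) maps the kernel of A(x) isomorphically onto the kernel of Ā(x). -/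
open Matrix

/-- Away from characteristic two, `vvᵗ` is isotropic for every skew-symmetric matrix. -/
theorem vecMulVec_mul_skew_mul_vecMulVec {k n : Type*} [Field k] [Fintype n]
    (h2 : (2 : k) ≠ 0) (σ : Matrix n n k) (hσ : σᵀ = -σ) (v : n → k) :
    vecMulVec v v * σ * vecMulVec v v = 0 := by
  have hv : v ⬝ᵥ σ *ᵥ v = 0 := by
    have h : v ⬝ᵥ σ *ᵥ v = -(v ⬝ᵥ σ *ᵥ v) := by
      conv_lhs => rw [dotProduct_comm, ← vecMul_transpose, ← dotProduct_mulVec, hσ, neg_mulVec,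
        dotProduct_neg]
    have h' : (2 : k) * (v ⬝ᵥ σ *ᵥ v) = 0 := by linear_combination h
    exact (mul_eq_zero.mp h').resolve_left h2
  rw [Matrix.mul_assoc, mul_vecMulVec, vecMulVec_mul_vecMulVec, hv, zero_smul, vecMulVec_zero]

/-- The congruence identity of a Type II transformation, for a element `P` of an
algebra that is isotropic for `σ1` and `σ2` and annihilated by `A(λ)` on both sides. -/
theorem typeII_congruence {k R : Type*} [Field k] [Ring R] [Algebra k R] (σ1 σ2 γ P : R)
    (l1 l2 t1 t2 x0 x1 x2 r : k)
    (h1 : P * σ1 * P = 0) (h2 : P * σ2 * P = 0)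
    (hAP : (l1 • σ2 - l2 • σ1 + γ) * P = 0) (hPA : P * (l1 • σ2 - l2 • σ1 + γ) = 0)
    (hδ : t1 * (x1 - l1 * x0) + t2 * (x2 - l2 * x0) ≠ 0) :
    x1 • σ2 - x2 • σ1 + x0 • γ =
      (1 - (r * x0 * (t1 * (x1 - l1 * x0) + t2 * (x2 - l2 * x0))⁻¹) •
          ((t1 • σ1 + t2 • σ2) * P)) *
        (x1 • σ2 - x2 • σ1 + x0 • (γ + r • (σ1 * P * σ2 - σ2 * P * σ1))) *
        (1 + (r * x0 * (t1 * (x1 - l1 * x0) + t2 * (x2 - l2 * x0))⁻¹) •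
          (P * (t1 • σ1 + t2 • σ2))) := by
  set a := x1 - l1 * x0 with ha
  set b := x2 - l2 * x0 with hb
  set c := r * x0 * (t1 * a + t2 * b)⁻¹ with hc
  have hcδ : c * (t1 * a + t2 * b) = r * x0 := by rw [hc, inv_mul_cancel_right₀ hδ]
  have hA : x1 • σ2 - x2 • σ1 + x0 • γ =
      (a • σ2 - b • σ1) + x0 • (l1 • σ2 - l2 • σ1 + γ) := by
    rw [ha, hb]; module
  set A := x1 • σ2 - x2 • σ1 + x0 • γ with hAdef
  set S := σ1 * P * σ2 - σ2 * P * σ1 with hS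
  set T := t1 • σ1 + t2 • σ2 with hT
  have hAP' : A * P = (a • σ2 - b • σ1) * P := by
    rw [hA, add_mul, smul_mul_assoc, hAP, smul_zero, add_zero]
  have hPA' : P * A = P * (a • σ2 - b • σ1) := by
    rw [hA, mul_add, mul_smul_comm, hPA, smul_zero, add_zero]
  have hPTP : P * T * P = 0 := by
    simp only [hT, mul_add, add_mul, mul_smul_comm, smul_mul_assoc, h1, h2, smul_zero, add_zero]
  have hPAP : P * A * P = 0 := by
    rw [hPA']
    simp only [mul_sub, sub_mul, mul_smul_comm, smul_mul_assoc, h1, h2, smul_zero, sub_zero]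
  have hSP : S * P = 0 := by
    have e : S * P = σ1 * (P * σ2 * P) - σ2 * (P * σ1 * P) := by rw [hS]; noncomm_ring
    rw [e, h1, h2, mul_zero, mul_zero, sub_zero]
  have hPS : P * S = 0 := by
    have e : P * S = (P * σ1 * P) * σ2 - (P * σ2 * P) * σ1 := by rw [hS]; noncomm_ring
    rw [e, h1, h2, zero_mul, zero_mul, sub_zero]
  have hcomm : A * P * T - T * (P * A) = -(t1 * a + t2 * b) • S := by
    rw [hAP', hPA', hT, hS]
    simp only [mul_add, add_mul, mul_sub, sub_mul, mul_smul_comm, smul_mul_assoc, mul_assoc]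
    module
  have hB : x1 • σ2 - x2 • σ1 + x0 • (γ + r • S) = A + (r * x0) • S := by
    rw [hAdef]; module
  have hBQ : (A + (r * x0) • S) * (1 + c • (P * T)) =
      A + (r * x0) • S + c • (A * P * T) := by
    rw [mul_add, mul_one, mul_smul_comm, ← mul_assoc, add_mul, smul_mul_assoc, hSP, smul_zero,
      add_zero]
  have hPBQ : P * (A + (r * x0) • S + c • (A * P * T)) = P * A := by
    rw [mul_add, mul_add, mul_smul_comm, mul_smul_comm, hPS, smul_zero, add_zero,
      ← mul_assoc, ← mul_assoc, hPAP, zero_mul, smul_zero, add_zero]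
  rw [hB, mul_assoc, hBQ, sub_mul, one_mul, smul_mul_assoc, mul_assoc T, hPBQ]
  rw [add_sub_assoc, ← smul_sub, hcomm, ← hcδ]
  module

/-- An invertible congruence `A = Qᵀ B Q` carries the kernel of `A` onto the kernel of `B`. -/
theorem map_ker_mulVecLin_of_congruence {k n : Type*} [Field k] [Fintype n] [DecidableEq n]
    {A B Q R : Matrix n n k} (hQR : Q * R = 1) (h : A = Qᵀ * B * Q) :
    Submodule.map Q.mulVecLin (LinearMap.ker A.mulVecLin) = LinearMap.ker B.mulVecLin := by
  have hRQ : Rᵀ * Qᵀ = 1 := by rw [← transpose_mul, hQR, transpose_one]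
  ext y
  simp only [Submodule.mem_map, LinearMap.mem_ker, mulVecLin_apply]
  constructor
  · rintro ⟨x, hx, rfl⟩
    have hBQ : B * Q = Rᵀ * A := by
      rw [h, ← Matrix.mul_assoc, ← Matrix.mul_assoc, hRQ, Matrix.one_mul]
    rw [mulVec_mulVec, hBQ, ← mulVec_mulVec, hx, mulVec_zero]
  · intro hy
    refine ⟨R *ᵥ y, ?_, by rw [mulVec_mulVec, hQR, one_mulVec]⟩
    rw [mulVec_mulVec, h, Matrix.mul_assoc, hQR, Matrix.mul_one, ← mulVec_mulVec, hy, mulVec_zero]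

/-- **Type II transformations act on the cokernel bundle.**  In the Type II setup, with
`Σ = t₁σ₁ + t₂σ₂`, `δ_λ(x) = t₁(x₁ − λ₁x₀) + t₂(x₂ − λ₂x₀)` and
`Q = Id + 2ρx₀δ_λ(x)⁻¹vvᵗΣ`, whenever `δ_λ(x) ≠ 0`: `Q` is invertible with inverse
`Id − 2ρx₀δ_λ(x)⁻¹vvᵗΣ`, one has `A(x) = Qᵗ·Ā(x)·Q`, and `Q` maps the kernel of
`A(x)` isomorphically onto the kernel of `Ā(x)`. -/
theorem stmt19 {k : Type} [Field k] [IsAlgClosed k] (d : ℕ)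
    (σ1 σ2 γ : Matrix (Fin (2 * d)) (Fin (2 * d)) k)
    (hσ1 : σ1ᵀ = -σ1) (hσ2 : σ2ᵀ = -σ2) (hγ : γᵀ = -γ)
    (l1 l2 : k) (v : Fin (2 * d) → k) (hv0 : v ≠ 0)
    (hv : (l1 • σ2 - l2 • σ1 + γ).mulVec v = 0)
    (ρ : k)
    (γb : Matrix (Fin (2 * d)) (Fin (2 * d)) k)
    (hγb : γb = γ + (2 * ρ) • (σ1 * vecMulVec v v * σ2 - σ2 * vecMulVec v v * σ1))
    (t1 t2 : k) :
    ∀ x0 x1 x2 : k,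
      t1 * (x1 - l1 * x0) + t2 * (x2 - l2 * x0) ≠ 0 →
      ∀ Q : Matrix (Fin (2 * d)) (Fin (2 * d)) k,
        Q = 1 + (2 * ρ * x0 * (t1 * (x1 - l1 * x0) + t2 * (x2 - l2 * x0))⁻¹) •
              (vecMulVec v v * (t1 • σ1 + t2 • σ2)) →
        (Q * (1 - (2 * ρ * x0 * (t1 * (x1 - l1 * x0) + t2 * (x2 - l2 * x0))⁻¹) •
              (vecMulVec v v * (t1 • σ1 + t2 • σ2))) = 1 ∧
          (1 - (2 * ρ * x0 * (t1 * (x1 - l1 * x0) + t2 * (x2 - l2 * x0))⁻¹) •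
              (vecMulVec v v * (t1 • σ1 + t2 • σ2))) * Q = 1) ∧
        x1 • σ2 - x2 • σ1 + x0 • γ = Qᵀ * (x1 • σ2 - x2 • σ1 + x0 • γb) * Q ∧
        Submodule.map Q.mulVecLin
            (LinearMap.ker (x1 • σ2 - x2 • σ1 + x0 • γ).mulVecLin) =
          LinearMap.ker (x1 • σ2 - x2 • σ1 + x0 • γb).mulVecLin := by
  intro x0 x1 x2 hδ Q hQ
  by_cases h2 : (2 : k) = 0
  · simp only [h2, zero_mul, zero_smul, add_zero] at hQ hγb
    subst hQ hγb
    simp [h2]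
  have h1P := vecMulVec_mul_skew_mul_vecMulVec h2 σ1 hσ1 v
  have h2P := vecMulVec_mul_skew_mul_vecMulVec h2 σ2 hσ2 v
  have hPt : (vecMulVec v v)ᵀ = vecMulVec v v := transpose_vecMulVec v v
  have hAP : (l1 • σ2 - l2 • σ1 + γ) * vecMulVec v v = 0 := by
    rw [mul_vecMulVec, hv, zero_vecMulVec]
  have hPA : vecMulVec v v * (l1 • σ2 - l2 • σ1 + γ) = 0 := by
    have hskew : (l1 • σ2 - l2 • σ1 + γ)ᵀ = -(l1 • σ2 - l2 • σ1 + γ) := by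
      rw [transpose_add, transpose_sub, transpose_smul, transpose_smul, hσ1, hσ2, hγ]
      module
    have h := congrArg transpose hAP
    rwa [transpose_mul, hPt, hskew, transpose_zero, Matrix.mul_neg, neg_eq_zero] at h
  have hcong := typeII_congruence σ1 σ2 γ (vecMulVec v v) l1 l2 t1 t2 x0 x1 x2 (2 * ρ)
    h1P h2P hAP hPA hδ
  set c := 2 * ρ * x0 * (t1 * (x1 - l1 * x0) + t2 * (x2 - l2 * x0))⁻¹
  set N := vecMulVec v v * (t1 • σ1 + t2 • σ2) with hN
  have hNN : N * N = 0 := by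
    have hPTP : N * vecMulVec v v = 0 := by
      simp only [hN, Matrix.mul_add, Matrix.add_mul, Matrix.mul_smul, Matrix.smul_mul, h1P, h2P,
        smul_zero, add_zero]
    rw [hN, ← Matrix.mul_assoc, ← hN, hPTP, Matrix.zero_mul]
  have hQR : Q * (1 - c • N) = 1 := by
    rw [hQ, Matrix.add_mul, Matrix.one_mul, Matrix.mul_sub, Matrix.mul_one, Matrix.smul_mul,
      Matrix.mul_smul, hNN, smul_zero, smul_zero, sub_zero, sub_add_cancel]
  have hQt : Qᵀ = 1 - c • ((t1 • σ1 + t2 • σ2) * vecMulVec v v) := by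
    have hT : (t1 • σ1 + t2 • σ2)ᵀ = -(t1 • σ1 + t2 • σ2) := by
      rw [transpose_add, transpose_smul, transpose_smul, hσ1, hσ2]
      module
    rw [hQ, transpose_add, transpose_one, transpose_smul, hN, transpose_mul, hPt, hT,
      Matrix.neg_mul, smul_neg, sub_eq_add_neg]
  rw [← hγb, ← hQt, ← hQ] at hcong
  exact ⟨⟨hQR, mul_eq_one_comm.mp hQR⟩, hcong, map_ker_mulVecLin_of_congruence hQR hcong⟩
end
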